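/- Let 𝒯 be an acceptable labelled tree for ψ and E, let P be the protocol derived from 𝒯, and let ℐ = ℐ(P,E) be the generated interpreted system. Then for every point (r,m) of ℐ and every subformula φ of ψ: 𝒯,(r,m) ⊨* φ if and only if ℐ,(r,m) ⊨ φ, where 𝒯,(r,m) ⊨* φ abbreviates 𝒯, r_1(0), (r,m) ⊨* φ. -/

import Mathlib

/-! Single-agent framework: formulas of the logic of knowledge and branching time,
finite interpreted environments, runs, protocols, generated interpreted systems,
satisfaction, realizability, labelled trees and acceptability. -/

/-- Formulae of the logic of knowledge and (branching/linear) time for a single agent: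
atomic propositions, ¬, ∧, ○ (next), U (until), ∃ (branching quantifier), K₁. -/
inductive Fml (PP : Type) : Type
  | tru : Fml PP
  | atom : PP → Fml PP
  | neg : Fml PP → Fml PP
  | conj : Fml PP → Fml PP → Fml PP
  | next : Fml PP → Fml PP
  | untl : Fml PP → Fml PP → Fml PP
  | exis : Fml PP → Fml PP
  | know : Fml PP → Fml PP

namespace Fml
variable {PP : Type}

/-- The list of subformulae of a formula. -/
def subf : Fml PP → List (Fml PP)
  | tru => [tru]
  | atom p => [atom p]
  | neg φ => neg φ :: φ.subf
  | conj φ ψ => conj φ ψ :: (φ.subf ++ ψ.subf)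
  | next φ => next φ :: φ.subf
  | untl φ ψ => untl φ ψ :: (φ.subf ++ ψ.subf)
  | exis φ => exis φ :: φ.subf
  | know φ => know φ :: φ.subf

/-- The size of a formula. -/
def size : Fml PP → ℕ
  | tru => 1
  | atom _ => 1
  | neg φ => φ.size + 1
  | conj φ ψ => φ.size + ψ.size + 1
  | next φ => φ.size + 1
  | untl φ ψ => φ.size + ψ.size + 1
  | exis φ => φ.size + 1
  | know φ => φ.size + 1

end Fml

/-- A (finite, when the state type is finite) interpreted environment for a single agent:
initial states, protocol of the environment (nonempty sets of environment actions),
transition function indexed by joint actions, observation function, interpretation. -/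
structure Env (S ACTe ACT1 O PP : Type) where
  initSt : Set S
  Pe : S → Set ACTe
  Pe_ne : ∀ s, (Pe s).Nonempty
  tr : ACTe × ACT1 → S → S
  obs : S → O
  val : S → PP → Bool

namespace Env
variable {S ACTe ACT1 O PP : Type}

/-- Synchronous perfect-recall local state `r₁(m) = O₁(r 0) … O₁(r m)`. -/
def locSt (E : Env S ACTe ACT1 O PP) (r : ℕ → S) (m : ℕ) : List O :=
  (List.range (m + 1)).map fun k => E.obs (r k)

/-- The runs of the interpreted system ℐ(P,E) generated by protocol `P` in `E`:
every transition is by a joint action allowed by the environment's protocol and by `P`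
at the current local state. -/
def IsRun (E : Env S ACTe ACT1 O PP) (P : List O → Set ACT1) (r : ℕ → S) : Prop :=
  r 0 ∈ E.initSt ∧ ∀ m, ∃ a : ACTe × ACT1,
    a.1 ∈ E.Pe (r m) ∧ a.2 ∈ P (E.locSt r m) ∧ r (m + 1) = E.tr a (r m)

/-- Satisfaction `ℐ(P,E),(r,m) ⊨ φ`. -/
def sat (E : Env S ACTe ACT1 O PP) (P : List O → Set ACT1) :
    (ℕ → S) → ℕ → Fml PP → Prop
  | _, _, .tru => True
  | r, m, .atom p => E.val (r m) p = true
  | r, m, .neg φ => ¬ E.sat P r m φ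
  | r, m, .conj φ ψ => E.sat P r m φ ∧ E.sat P r m ψ
  | r, m, .next φ => E.sat P r (m + 1) φ
  | r, m, .untl φ ψ => ∃ k, m ≤ k ∧ E.sat P r k ψ ∧ ∀ l, m ≤ l → l < k → E.sat P r l φ
  | r, m, .exis φ => ∃ r', E.IsRun P r' ∧ (∀ k, k ≤ m → r' k = r k) ∧ E.sat P r' m φ
  | r, m, .know φ => ∀ r' m', E.IsRun P r' → E.locSt r' m' = E.locSt r m → E.sat P r' m' φ

/-- `P` realizes `ψ` in `E`: `ψ` holds at time 0 of every run of ℐ(P,E). -/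
def Realizes (E : Env S ACTe ACT1 O PP) (P : List O → Set ACT1) (ψ : Fml PP) : Prop :=
  ∀ r, E.IsRun P r → E.sat P r 0 ψ

/-- `ψ` is realizable in `E`: some protocol (with nonempty action sets) realizes it. -/
def Realizable (E : Env S ACTe ACT1 O PP) (ψ : Fml PP) : Prop :=
  ∃ P : List O → Set ACT1, (∀ v, (P v).Nonempty) ∧ E.Realizes P ψ

end Env

/-- A label: a knowledge set (a set of pairs of an atom -- a Boolean valuation of formulae --
and a state) together with a set of agent-1 actions. -/
abbrev KLabel (S ACT1 PP : Type) : Type := Set ((Fml PP → Bool) × S) × Set ACT1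

/-- A labelled tree for ψ and E: a labelling of 𝒪* by labels. -/
abbrev LTree (S ACT1 O PP : Type) : Type := List O → KLabel S ACT1 PP

namespace Env
variable {S ACTe ACT1 O PP : Type}

/-- The branch of vertices determined by starting vertex `v` and state sequence `r`:
`v₀ = v`, `v_{m+1} = v_m · O₁(r (m+1))`. -/
def vtx (E : Env S ACTe ACT1 O PP) (v : List O) (r : ℕ → S) : ℕ → List O
  | 0 => v
  | m + 1 => E.vtx v r m ++ [E.obs (r (m + 1))]

/-- A run of the labelled tree `T` from vertex `v`. -/
def IsTreeRun (E : Env S ACTe ACT1 O PP) (T : LTree S ACT1 O PP) (v : List O)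
    (r : ℕ → S) : Prop :=
  (∃ X, (X, r 0) ∈ (T v).1) ∧ ∀ m, ∃ a : ACTe × ACT1,
    a.1 ∈ E.Pe (r m) ∧ a.2 ∈ (T (E.vtx v r m)).2 ∧ r (m + 1) = E.tr a (r m)

/-- The relation `𝒯,v,(r,m) ⊨* φ`. -/
def tsat (E : Env S ACTe ACT1 O PP) (T : LTree S ACT1 O PP) (v : List O) :
    (ℕ → S) → ℕ → Fml PP → Prop
  | _, _, .tru => True
  | r, m, .atom p => E.val (r m) p = true
  | r, m, .neg φ => ¬ E.tsat T v r m φ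
  | r, m, .conj φ ψ => E.tsat T v r m φ ∧ E.tsat T v r m ψ
  | r, m, .next φ => E.tsat T v r (m + 1) φ
  | r, m, .untl φ ψ => ∃ k, m ≤ k ∧ E.tsat T v r k ψ ∧ ∀ l, m ≤ l → l < k → E.tsat T v r l φ
  | r, m, .exis φ => ∃ X : Fml PP → Bool, (X, r m) ∈ (T (E.vtx v r m)).1 ∧ X φ = true
  | r, m, .know φ => ∀ X s, (X, s) ∈ (T (E.vtx v r m)).1 → X φ = true

/-- Acceptability of a labelled tree for ψ and E: the conditions Real, Init, Obs, Pred,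
Succ, ∃sound, ∃comp, Ksound, Kcomp (plus nonemptiness of the action labels, part of
being a labelled tree). -/
structure Acceptable (E : Env S ACTe ACT1 O PP) (ψ : Fml PP) (T : LTree S ACT1 O PP) :
    Prop where
  actNe : ∀ v, (T v).2.Nonempty
  real : ∀ (o : O) X s, (X, s) ∈ (T [o]).1 → X ψ = true ∧ s ∈ E.initSt
  initC : ∀ s ∈ E.initSt, ∃ X, (X, s) ∈ (T [E.obs s]).1
  obsC : ∀ (v : List O) (o : O) X s, (X, s) ∈ (T (v ++ [o])).1 → E.obs s = o
  pred : ∀ (v : List O) (o : O) X s, v ≠ [] → (X, s) ∈ (T (v ++ [o])).1 →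
    ∃ Y t, ∃ a : ACTe × ACT1, (Y, t) ∈ (T v).1 ∧ a.1 ∈ E.Pe t ∧ a.2 ∈ (T v).2 ∧ s = E.tr a t
  succ : ∀ (v : List O) X s, ∀ a : ACTe × ACT1, v ≠ [] → (X, s) ∈ (T v).1 →
    a.1 ∈ E.Pe s → a.2 ∈ (T v).2 →
    ∃ Y, (Y, E.tr a s) ∈ (T (v ++ [E.obs (E.tr a s)])).1
  exSound : ∀ (v : List O) X s φ, (Fml.exis φ) ∈ ψ.subf → (X, s) ∈ (T v).1 →
    X (Fml.exis φ) = true → ∃ Y, (Y, s) ∈ (T v).1 ∧ Y φ = true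
  exComp : ∀ (v : List O) X Y s φ, (Fml.exis φ) ∈ ψ.subf → (X, s) ∈ (T v).1 →
    (Y, s) ∈ (T v).1 → X φ = true → Y (Fml.exis φ) = true
  ksound : ∀ (v : List O) X s, v ≠ [] → (X, s) ∈ (T v).1 →
    ∃ r, E.IsTreeRun T v r ∧ r 0 = s ∧ ∀ φ ∈ ψ.subf, (E.tsat T v r 0 φ ↔ X φ = true)
  kcomp : ∀ (v : List O) r, E.IsTreeRun T v r →
    ∃ X, (X, r 0) ∈ (T v).1 ∧ ∀ φ ∈ ψ.subf, (E.tsat T v r 0 φ ↔ X φ = true)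

end Env

theorem Fml.self_subf {PP : Type} (φ : Fml PP) : φ ∈ φ.subf := by
  cases φ <;> simp [Fml.subf]

theorem Fml.subf_trans {PP : Type} {χ φ : Fml PP} (h : χ ∈ φ.subf) :
    ∀ {ψ : Fml PP}, φ ∈ ψ.subf → χ ∈ ψ.subf := by
  intro ψ
  induction ψ with
  | tru => intro h1; simp only [Fml.subf, List.mem_singleton] at h1; subst h1; exact h
  | atom p => intro h1; simp only [Fml.subf, List.mem_singleton] at h1; subst h1; exact h
  | neg a ih | next a ih | exis a ih | know a ih =>
    intro h1
    rcases List.mem_cons.1 h1 with h1 | h1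
    · subst h1; exact h
    · exact List.mem_cons_of_mem _ (ih h1)
  | conj a b iha ihb | untl a b iha ihb =>
    intro h1
    rcases List.mem_cons.1 h1 with h1 | h1
    · subst h1; exact h
    · rcases List.mem_append.1 h1 with h1 | h1
      · exact List.mem_cons_of_mem _ (List.mem_append_left _ (iha h1))
      · exact List.mem_cons_of_mem _ (List.mem_append_right _ (ihb h1))

namespace Env
variable {S ACTe ACT1 O PP : Type}

theorem locSt_succ (E : Env S ACTe ACT1 O PP) (r : ℕ → S) (m : ℕ) :
    E.locSt r (m + 1) = E.locSt r m ++ [E.obs (r (m + 1))] := by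
  simp [locSt, List.range_succ (n := m + 1)]

theorem locSt_ne (E : Env S ACTe ACT1 O PP) (r : ℕ → S) (m : ℕ) : E.locSt r m ≠ [] := by
  simp [locSt]

theorem locSt_congr (E : Env S ACTe ACT1 O PP) (r r' : ℕ → S) (m : ℕ)
    (h : ∀ k, k ≤ m → r k = r' k) : E.locSt r m = E.locSt r' m := by
  unfold locSt
  apply List.map_congr_left
  intro k hk
  rw [h k (by have := List.mem_range.1 hk; omega)]

theorem vtx_add (E : Env S ACTe ACT1 O PP) (v : List O) (r : ℕ → S) (m k : ℕ) :
    E.vtx v r (m + k) = E.vtx (E.vtx v r m) (fun j => r (m + j)) k := by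
  induction k with
  | zero => rfl
  | succ k ih => rw [← Nat.add_assoc]; simp only [vtx, ih]; rfl

theorem vtx_locSt (E : Env S ACTe ACT1 O PP) (r : ℕ → S) (m : ℕ) :
    E.vtx (E.locSt r 0) r m = E.locSt r m := by
  induction m with
  | zero => rfl
  | succ k ih => rw [locSt_succ, vtx, ih]

theorem tsat_shift (E : Env S ACTe ACT1 O PP) (T : LTree S ACT1 O PP) (v : List O)
    (r : ℕ → S) (m : ℕ) (φ : Fml PP) : ∀ k,
    E.tsat T v r (m + k) φ ↔ E.tsat T (E.vtx v r m) (fun j => r (m + j)) k φ := by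
  induction φ with
  | tru => intro k; simp [tsat]
  | atom p => intro k; simp [tsat]
  | neg a ih => intro k; simp [tsat, ih]
  | conj a b iha ihb => intro k; simp [tsat, iha, ihb]
  | next a ih => intro k; simp only [tsat]; exact ih (k + 1)
  | exis a ih => intro k; simp only [tsat, vtx_add]
  | know a ih => intro k; simp only [tsat, vtx_add]
  | untl a b iha ihb =>
    intro k
    simp only [tsat]
    constructor
    · rintro ⟨j, hj, h1, h2⟩
      obtain ⟨i, rfl⟩ := Nat.exists_eq_add_of_le (show m ≤ j by omega)
      exact ⟨i, by omega, (ihb i).1 h1, fun l h3 h4 =>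
        (iha l).1 (h2 _ (by omega) (by omega))⟩
    · rintro ⟨i, hi, h1, h2⟩
      refine ⟨m + i, by omega, (ihb i).2 h1, fun l h3 h4 => ?_⟩
      obtain ⟨j, rfl⟩ := Nat.exists_eq_add_of_le (show m ≤ l by omega)
      exact (iha j).2 (h2 _ (by omega) (by omega))

/-- Every state reached by a run occurs in the knowledge set of its local state. -/
theorem run_mem (E : Env S ACTe ACT1 O PP) (ψ : Fml PP) (T : LTree S ACT1 O PP)
    (hT : E.Acceptable ψ T) (r : ℕ → S) (hr : E.IsRun (fun v => (T v).2) r) (m : ℕ) :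
    ∃ X, (X, r m) ∈ (T (E.locSt r m)).1 := by
  induction m with
  | zero => exact hT.initC _ hr.1
  | succ m ih =>
    obtain ⟨X, hX⟩ := ih
    obtain ⟨a, h1, h2, h3⟩ := hr.2 m
    rw [locSt_succ, h3]
    exact hT.succ _ X _ a (locSt_ne _ _ _) hX h1 h2

theorem tail_treeRun (E : Env S ACTe ACT1 O PP) (ψ : Fml PP) (T : LTree S ACT1 O PP)
    (hT : E.Acceptable ψ T) (r : ℕ → S) (hr : E.IsRun (fun v => (T v).2) r) (m : ℕ) :
    E.IsTreeRun T (E.locSt r m) (fun j => r (m + j)) := by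
  refine ⟨run_mem E ψ T hT r hr m, fun k => ?_⟩
  obtain ⟨a, h1, h2, h3⟩ := hr.2 (m + k)
  refine ⟨a, h1, ?_, h3⟩
  rw [← vtx_locSt E r m, ← vtx_add, vtx_locSt]
  exact h2

/-- A point of a run is described by an element of the knowledge set. -/
theorem run_atom (E : Env S ACTe ACT1 O PP) (ψ : Fml PP) (T : LTree S ACT1 O PP)
    (hT : E.Acceptable ψ T) (r : ℕ → S) (hr : E.IsRun (fun v => (T v).2) r) (m : ℕ) :
    ∃ X, (X, r m) ∈ (T (E.locSt r m)).1 ∧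
      ∀ φ ∈ ψ.subf, (E.tsat T (E.locSt r 0) r m φ ↔ X φ = true) := by
  obtain ⟨X, h1, h2⟩ := hT.kcomp _ _ (tail_treeRun E ψ T hT r hr m)
  refine ⟨X, h1, fun φ hφ => ?_⟩
  rw [← h2 φ hφ, ← vtx_locSt E r m]
  exact tsat_shift E T _ r m φ 0

/-- Partial runs of length `m`. -/
def PRun (E : Env S ACTe ACT1 O PP) (P : List O → Set ACT1) (r : ℕ → S) (m : ℕ) : Prop :=
  r 0 ∈ E.initSt ∧ ∀ k, k < m → ∃ a : ACTe × ACT1,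
    a.1 ∈ E.Pe (r k) ∧ a.2 ∈ P (E.locSt r k) ∧ r (k + 1) = E.tr a (r k)

theorem exists_prun (E : Env S ACTe ACT1 O PP) (ψ : Fml PP) (T : LTree S ACT1 O PP)
    (hT : E.Acceptable ψ T) (v : List O) : ∀ X s, v ≠ [] → (X, s) ∈ (T v).1 →
    ∃ r m, E.PRun (fun v => (T v).2) r m ∧ E.locSt r m = v ∧ r m = s := by
  induction v using List.reverseRecOn with
  | nil => intro X s h; exact absurd rfl h
  | append_singleton v o ih =>
    intro X s _ hX
    have ho := hT.obsC v o X s hX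
    by_cases hv : v = []
    · subst hv
      refine ⟨fun _ => s, 0, ⟨(hT.real o X s hX).2, fun k hk => absurd hk (by omega)⟩, ?_, rfl⟩
      simp [locSt, ho]
    · obtain ⟨Y, t, a, h1, h2, h3, h4⟩ := hT.pred v o X s hv hX
      obtain ⟨r, m, hp, hl, ht⟩ := ih Y t hv h1
      have hag : ∀ j, j ≤ m → ∀ k, k ≤ j → (fun k => if k ≤ m then r k else s) k = r k := by
        intro j hj k hk
        simp [show k ≤ m by omega]
      refine ⟨fun k => if k ≤ m then r k else s, m + 1, ⟨by simpa using hp.1, ?_⟩, ?_, by simp⟩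
      · intro k hk
        rw [locSt_congr E _ r k (hag k (by omega))]
        by_cases hkm : k < m
        · obtain ⟨b, h5, h6, h7⟩ := hp.2 k hkm
          refine ⟨b, ?_, h6, ?_⟩
          · simpa [show k ≤ m by omega] using h5
          · simpa [show k ≤ m by omega, show k + 1 ≤ m by omega] using h7
        · obtain rfl : k = m := by omega
          refine ⟨a, ?_, ?_, ?_⟩
          · simpa [ht] using h2
          · simpa [hl] using h3
          · simpa [ht] using h4
      · rw [locSt_succ, locSt_congr E _ r m (hag m le_rfl), hl]
        simp [ho]

/-- Any element of the knowledge set describes a point of a run extending a partial run. -/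
theorem atom_run (E : Env S ACTe ACT1 O PP) (ψ : Fml PP) (T : LTree S ACT1 O PP)
    (hT : E.Acceptable ψ T) (p : ℕ → S) (m : ℕ) (hp : E.PRun (fun v => (T v).2) p m)
    (X : Fml PP → Bool) (hX : (X, p m) ∈ (T (E.locSt p m)).1) :
    ∃ r, E.IsRun (fun v => (T v).2) r ∧ (∀ k, k ≤ m → r k = p k) ∧
      ∀ φ ∈ ψ.subf, (E.tsat T (E.locSt r 0) r m φ ↔ X φ = true) := by
  obtain ⟨q, hq, hq0, hs⟩ := hT.ksound _ X _ (locSt_ne _ _ _) hX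
  obtain ⟨r, hrd⟩ : ∃ r : ℕ → S, r = fun k => if k ≤ m then p k else q (k - m) := ⟨_, rfl⟩
  have hag : ∀ k, k ≤ m → r k = p k := by
    intro k hk; simp [hrd, hk]
  have htl : (fun j => r (m + j)) = q := by
    funext j
    by_cases hj : j = 0
    · subst hj; simp [hrd, hq0]
    · simp [hrd, hj]
  have htl' : ∀ j, r (m + j) = q j := fun j => congrFun htl j
  have hloc : E.locSt r m = E.locSt p m := locSt_congr E _ _ _ hag
  refine ⟨r, ⟨by rw [hag 0 (by omega)]; exact hp.1, fun k => ?_⟩, hag, fun φ hφ => ?_⟩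
  · by_cases hk : k < m
    · obtain ⟨a, h1, h2, h3⟩ := hp.2 k hk
      refine ⟨a, ?_, ?_, ?_⟩
      · rw [hag k (by omega)]; exact h1
      · rw [locSt_congr E r p k (fun j hj => hag j (by omega))]; exact h2
      · rw [hag k (by omega), hag (k + 1) (by omega)]; exact h3
    · obtain ⟨j, rfl⟩ := Nat.exists_eq_add_of_le (show m ≤ k by omega)
      obtain ⟨a, h1, h2, h3⟩ := hq.2 j
      refine ⟨a, ?_, ?_, ?_⟩
      · rw [htl']; exact h1
      · rw [← vtx_locSt, vtx_add, vtx_locSt, htl, hloc]; exact h2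
      · rw [Nat.add_assoc, htl', htl']; exact h3
  · rw [← hs φ hφ]
    have := tsat_shift E T (E.locSt r 0) r m φ 0
    rw [vtx_locSt, htl, hloc] at this
    exact this

theorem main_aux (E : Env S ACTe ACT1 O PP) (ψ : Fml PP) (T : LTree S ACT1 O PP)
    (hT : E.Acceptable ψ T) (φ : Fml PP) : φ ∈ ψ.subf → ∀ (r : ℕ → S) (m : ℕ),
    E.IsRun (fun v => (T v).2) r →
    (E.tsat T (E.locSt r 0) r m φ ↔ E.sat (fun v => (T v).2) r m φ) := by
  induction φ with
  | tru => intros; simp [tsat, sat]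
  | atom p => intros; simp [tsat, sat]
  | neg a ih =>
    intro h r m hr
    have ha : a ∈ ψ.subf := Fml.subf_trans (by simp [Fml.subf, Fml.self_subf]) h
    simp only [tsat, sat, ih ha r m hr]
  | conj a b iha ihb =>
    intro h r m hr
    have ha : a ∈ ψ.subf := Fml.subf_trans (by simp [Fml.subf, Fml.self_subf]) h
    have hb : b ∈ ψ.subf := Fml.subf_trans (by simp [Fml.subf, Fml.self_subf]) h
    simp only [tsat, sat, iha ha r m hr, ihb hb r m hr]
  | next a ih =>
    intro h r m hr
    have ha : a ∈ ψ.subf := Fml.subf_trans (by simp [Fml.subf, Fml.self_subf]) h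
    simp only [tsat, sat, ih ha r _ hr]
  | untl a b iha ihb =>
    intro h r m hr
    have ha : a ∈ ψ.subf := Fml.subf_trans (by simp [Fml.subf, Fml.self_subf]) h
    have hb : b ∈ ψ.subf := Fml.subf_trans (by simp [Fml.subf, Fml.self_subf]) h
    simp only [tsat, sat, iha ha r _ hr, ihb hb r _ hr]
  | exis a ih =>
    intro h r m hr
    have ha : a ∈ ψ.subf := Fml.subf_trans (by simp [Fml.subf, Fml.self_subf]) h
    simp only [tsat, sat, vtx_locSt]
    constructor
    · rintro ⟨X, hX, hXa⟩
      obtain ⟨r', h1, h2, h3⟩ := atom_run E ψ T hT r m ⟨hr.1, fun k _ => hr.2 k⟩ X hX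
      exact ⟨r', h1, h2, (ih ha r' m h1).1 ((h3 a ha).2 hXa)⟩
    · rintro ⟨r', h1, h2, h3⟩
      obtain ⟨X, h4, h5⟩ := run_atom E ψ T hT r' h1 m
      rw [locSt_congr E r' r m h2, h2 m le_rfl] at h4
      exact ⟨X, h4, (h5 a ha).1 ((ih ha r' m h1).2 h3)⟩
  | know a ih =>
    intro h r m hr
    have ha : a ∈ ψ.subf := Fml.subf_trans (by simp [Fml.subf, Fml.self_subf]) h
    simp only [tsat, sat, vtx_locSt]
    constructor
    · intro hk r' m' h1 h2
      obtain ⟨X, h4, h5⟩ := run_atom E ψ T hT r' h1 m'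
      rw [h2] at h4
      exact (ih ha r' m' h1).1 ((h5 a ha).2 (hk _ _ h4))
    · intro hk X s hX
      obtain ⟨p, n, hp, hl, rfl⟩ := exists_prun E ψ T hT _ X s (locSt_ne _ _ _) hX
      obtain ⟨r', h1, h2, h3⟩ := atom_run E ψ T hT p n hp X (by rw [hl]; exact hX)
      exact (h3 a ha).1 ((ih ha r' n h1).2
        (hk r' n h1 (by rw [locSt_congr E r' p n h2, hl])))

end Env

/-- **Theorem.** Let 𝒯 be an acceptable labelled tree for ψ and E, P the protocol derived
from 𝒯, and ℐ = ℐ(P,E).  For every point (r,m) of ℐ and every subformula φ of ψ: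
𝒯,(r,m) ⊨* φ (i.e. 𝒯, r₁(0), (r,m) ⊨* φ) iff ℐ,(r,m) ⊨ φ. -/
theorem stmt2 {S ACTe ACT1 O PP : Type} [Fintype S] [Fintype ACTe] [Fintype ACT1]
    [Fintype O] (E : Env S ACTe ACT1 O PP) (ψ : Fml PP) (T : LTree S ACT1 O PP)
    (hT : E.Acceptable ψ T) (r : ℕ → S) (m : ℕ)
    (hr : E.IsRun (fun v => (T v).2) r) (φ : Fml PP) (hφ : φ ∈ ψ.subf) :
    E.tsat T (E.locSt r 0) r m φ ↔ E.sat (fun v => (T v).2) r m φ := by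
  exact Env.main_aux E ψ T hT φ hφ r m hr
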